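/- Small endpoint local limit theorem (Theorem 1.1(ii)). Assume P(ξ=0) > 0 and P(ξ=1) > 0, and let (x_n)_{n≥1} be positive integers with x_n → ∞ and x_n/n → 0. For all n large enough let b_n ∈ (0,ρ) be defined by Ψ(b_n) = x_n/n, and set v_n² = x_n. Then sup_{k ≥ −x_n} | v_n · (b_n^{x_n+k}/G(b_n)^n) · P(S_n = x_n+k) − (2π)^{−1/2} exp(−k²/(2v_n²)) | → 0 as n → ∞. -/

import Mathlib

set_option autoImplicit false

open Filter Topology

/-- `convPow p n x` is the probability `P(S_n = x)` where `S_n = ξ_1 + ⋯ + ξ_n` is a sum of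
`n` i.i.d. nonnegative-integer random variables with `P(ξ = k) = p k`. -/
noncomputable def convPow (p : ℕ → ℝ) : ℕ → ℕ → ℝ
  | 0, x => if x = 0 then 1 else 0
  | n + 1, x => ∑ j ∈ Finset.range (x + 1), convPow p n (x - j) * p j

/-- The generating function `G(s) = ∑_k p k s^k`. -/
noncomputable def genFun (p : ℕ → ℝ) (s : ℝ) : ℝ := ∑' k : ℕ, p k * s ^ k

/-- `Ψ(b) = b G'(b) / G(b)`, the mean of the tilted variable `ξ^{(b)}`. -/
noncomputable def PsiFun (p : ℕ → ℝ) (b : ℝ) : ℝ :=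
  b * deriv (genFun p) b / genFun p b

/-- The characteristic function of the distribution `q`. -/
noncomputable def chf (q : ℕ → ℝ) (t : ℝ) : ℂ := ∑' k : ℕ, (q k : ℂ) * Complex.exp (Complex.I * t) ^ k

lemma norm_eit (t : ℝ) : ‖Complex.exp (Complex.I * t)‖ = 1 := by
  rw [mul_comm]; exact Complex.norm_exp_ofReal_mul_I t

lemma pow_taylor (z : ℂ) (hz : ‖z‖ = 1) (k : ℕ) :
    ‖z ^ k - 1 - k * (z - 1)‖ ≤ (k : ℝ) * ((k : ℝ) - 1) / 2 * ‖z - 1‖ ^ 2 := by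
  induction k with
  | zero => simp
  | succ k ih =>
    have e : z ^ (k + 1) - 1 - ((k + 1 : ℕ) : ℂ) * (z - 1)
        = z * (z ^ k - 1 - k * (z - 1)) + k * (z - 1) ^ 2 := by
      push_cast; ring
    rw [e]
    refine (norm_add_le _ _).trans ?_
    rw [norm_mul, norm_mul, norm_pow, hz, Complex.norm_natCast]
    push_cast
    nlinarith

lemma chf_summable (q : ℕ → ℝ) (hq : ∀ k, 0 ≤ q k) (h1 : HasSum q 1) (t : ℝ) :
    Summable (fun k : ℕ => ‖(q k : ℂ) * Complex.exp (Complex.I * t) ^ k‖) := by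
  refine h1.summable.congr fun k => ?_
  rw [norm_mul, norm_pow, norm_eit, one_pow, mul_one, Complex.norm_real, Real.norm_of_nonneg (hq k)]

lemma chf_taylor (q : ℕ → ℝ) (hq : ∀ k, 0 ≤ q k) (h1 : HasSum q 1) (m V : ℝ)
    (hm : HasSum (fun k : ℕ => (k : ℝ) * q k) m)
    (hV : HasSum (fun k : ℕ => (k : ℝ) * ((k : ℝ) - 1) * q k) V) (t : ℝ) :
    ‖chf q t - 1 - m * (Complex.exp (Complex.I * t) - 1)‖ ≤ V / 2 * t ^ 2 := by
  set z := Complex.exp (Complex.I * t) with hz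
  have hz1 : ‖z - 1‖ ≤ |t| := Real.norm_exp_I_mul_ofReal_sub_one_le
  have a := (chf_summable q hq h1 t).of_norm.hasSum
  have b : HasSum (fun k : ℕ => (q k : ℂ)) (1 : ℂ) := by
    have := Complex.hasSum_ofReal.2 h1
    rwa [Complex.ofReal_one] at this
  have c : HasSum (fun k : ℕ => (((k : ℝ) * q k : ℝ) : ℂ)) (m : ℂ) := Complex.hasSum_ofReal.2 hm
  have d := (a.sub b).sub (c.mul_right (z - 1))
  have hV' := hV.mul_right (t ^ 2 / 2)
  have key := tsum_of_norm_bounded (f := fun k : ℕ => (q k : ℂ) * Complex.exp (Complex.I * t) ^ k - q k - (((k : ℝ) * q k : ℝ) : ℂ) * (z - 1)) hV' ?_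
  · rw [d.tsum_eq] at key
    unfold chf
    calc _ ≤ _ := key
      _ = _ := by ring
  · intro k
    rw [← hz]
    have e : (q k : ℂ) * z ^ k - q k - (((k : ℝ) * q k : ℝ) : ℂ) * (z - 1)
      = q k * (z ^ k - 1 - k * (z - 1)) := by push_cast; ring
    rw [e, norm_mul, Complex.norm_real, Real.norm_of_nonneg (hq k)]
    have h2 := pow_taylor z (norm_eit t) k
    have h3 : ‖z - 1‖ ^ 2 ≤ t ^ 2 := by
      rw [← sq_abs t]; gcongr
    have h4 : (0 : ℝ) ≤ (k : ℝ) * ((k : ℝ) - 1) := by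
      rcases k with _ | k
      · simp
      · push_cast; nlinarith [(Nat.cast_nonneg k : (0 : ℝ) ≤ k)]
    calc q k * ‖z ^ k - 1 - k * (z - 1)‖
        ≤ q k * ((k : ℝ) * ((k : ℝ) - 1) / 2 * t ^ 2) := by
          apply mul_le_mul_of_nonneg_left _ (hq k)
          exact h2.trans (mul_le_mul_of_nonneg_left h3 (by linarith))
      _ = _ := by ring

lemma chf_norm_le_one (q : ℕ → ℝ) (hq : ∀ k, 0 ≤ q k) (h1 : HasSum q 1) (t : ℝ) :
    ‖chf q t‖ ≤ 1 := by
  refine tsum_of_norm_bounded h1 fun k => ?_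
  rw [norm_mul, norm_pow, norm_eit, one_pow, mul_one, Complex.norm_real, Real.norm_of_nonneg (hq k)]

lemma bern_norm (m t : ℝ) (hm0 : 0 ≤ m) (hm : m ≤ 1 / 2) (ht : |t| ≤ Real.pi) :
    ‖1 + m * (Complex.exp (Complex.I * t) - 1)‖ ≤ 1 - m * t ^ 2 / 10 := by
  have hpi : Real.pi < 3.15 := Real.pi_lt_d2
  have hpi0 := Real.pi_pos
  have hp2 : Real.pi ^ 2 ≤ 10 := by nlinarith
  have ht2 : t ^ 2 ≤ 10 := by
    rw [← sq_abs]; refine le_trans ?_ hp2; gcongr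
  have hcos := Real.cos_le_one_sub_mul_cos_sq ht
  have hc2 : Real.cos t ≤ 1 - t ^ 2 / 5 := by
    have : 1 / 5 ≤ 2 / Real.pi ^ 2 := by
      rw [div_le_div_iff₀ (by norm_num) (by positivity)]; linarith
    nlinarith [sq_nonneg t]
  have hm' : m * t ^ 2 ≤ 5 := by nlinarith [sq_nonneg t]
  apply le_of_sq_le_sq _ (by linarith)
  rw [Complex.sq_norm, Complex.normSq_apply]
  have hexp : Complex.exp (Complex.I * t) = Complex.cos t + Complex.sin t * Complex.I := by
    rw [mul_comm, Complex.exp_mul_I]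
  rw [hexp, ← Complex.ofReal_cos, ← Complex.ofReal_sin]
  simp only [Complex.add_re, Complex.add_im, Complex.mul_re, Complex.mul_im, Complex.sub_re, Complex.sub_im, Complex.one_re, Complex.one_im, Complex.ofReal_re, Complex.ofReal_im, Complex.I_re, Complex.I_im]
  have hsc := Real.sin_sq_add_cos_sq t
  have e : (1 + m * (Real.cos t - 1)) * (1 + m * (Real.cos t - 1)) + (m * Real.sin t) * (m * Real.sin t) = 1 - 2 * (m * (1 - m)) * (1 - Real.cos t) := by
    have : Real.sin t ^ 2 = 1 - Real.cos t ^ 2 := by linarith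
    linear_combination m ^ 2 * this
  have h5 : m / 2 * (t ^ 2 / 5) ≤ m * (1 - m) * (1 - Real.cos t) := by
    apply mul_le_mul _ (by linarith) (by positivity) (by nlinarith)
    nlinarith
  calc _ = 1 - 2 * (m * (1 - m)) * (1 - Real.cos t) := by rw [← e]; ring
    _ ≤ 1 - m * t ^ 2 / 5 := by nlinarith
    _ ≤ _ := by nlinarith [sq_nonneg (m * t ^ 2)]

lemma chf_norm_bound (q : ℕ → ℝ) (hq : ∀ k, 0 ≤ q k) (h1 : HasSum q 1) (m V : ℝ)
    (hm : HasSum (fun k : ℕ => (k : ℝ) * q k) m)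
    (hV : HasSum (fun k : ℕ => (k : ℝ) * ((k : ℝ) - 1) * q k) V) (hm0 : 0 ≤ m) (hm2 : m ≤ 1 / 2)
    (hVm : V ≤ m / 10) (t : ℝ) (ht : |t| ≤ Real.pi) :
    ‖chf q t‖ ≤ Real.exp (-(m * t ^ 2 / 20)) := by
  have h := chf_taylor q hq h1 m V hm hV t
  have h2 := bern_norm m t hm0 hm2 ht
  have h3 : ‖chf q t‖ ≤ ‖1 + m * (Complex.exp (Complex.I * t) - 1)‖ + ‖chf q t - 1 - m * (Complex.exp (Complex.I * t) - 1)‖ := by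
    refine le_trans (le_of_eq ?_) (norm_add_le _ _)
    congr 1; ring
  have h4 := Real.add_one_le_exp (-(m * t ^ 2 / 20))
  nlinarith [sq_nonneg t]

lemma pow_sub_pow_bound (a b : ℂ) (ha : ‖a‖ ≤ 1) (hb : ‖b‖ ≤ 1) (n : ℕ) :
    ‖a ^ n - b ^ n‖ ≤ n * ‖a - b‖ := by
  induction n with
  | zero => simp
  | succ n ih =>
    have e : a ^ (n + 1) - b ^ (n + 1) = a * (a ^ n - b ^ n) + (a - b) * b ^ n := by ring
    rw [e]
    refine (norm_add_le _ _).trans ?_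
    rw [norm_mul, norm_mul, norm_pow]
    have : ‖b‖ ^ n ≤ 1 := pow_le_one₀ (norm_nonneg _) hb
    push_cast
    have h1 : ‖a‖ * ‖a ^ n - b ^ n‖ ≤ 1 * (n * ‖a - b‖) := by gcongr
    have h2 : ‖a - b‖ * ‖b‖ ^ n ≤ ‖a - b‖ * 1 := by gcongr
    linarith

lemma chf_pow_hasSum (q : ℕ → ℝ) (hq : ∀ k, 0 ≤ q k) (h1 : HasSum q 1) (t : ℝ) (n : ℕ) :
    Summable (fun j : ℕ => ‖(convPow q n j : ℂ) * Complex.exp (Complex.I * t) ^ j‖) ∧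
    HasSum (fun j : ℕ => (convPow q n j : ℂ) * Complex.exp (Complex.I * t) ^ j) (chf q t ^ n) := by
  set z := Complex.exp (Complex.I * t) with hz
  induction n with
  | zero =>
    have e : ∀ j : ℕ, j ≠ 0 → (convPow q 0 j : ℂ) * z ^ j = 0 := by
      intro j hj; simp [convPow, hj]
    constructor
    · apply summable_of_ne_finset_zero (s := {0})
      intro j hj
      rw [e j (by simpa using hj), norm_zero]
    · have := hasSum_single (f := fun j : ℕ => (convPow q 0 j : ℂ) * z ^ j) 0 e
      simpa [convPow] using this
  | succ n ih =>
    have hs := chf_summable q hq h1 t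
    rw [← hz] at hs
    have e : ∀ j : ℕ, (convPow q (n + 1) j : ℂ) * z ^ j = ∑ k ∈ Finset.range (j + 1),
        ((q k : ℂ) * z ^ k) * ((convPow q n (j - k) : ℂ) * z ^ (j - k)) := by
      intro j
      rw [convPow]
      push_cast
      rw [Finset.sum_mul]
      refine Finset.sum_congr rfl fun k hk => ?_
      have : j = k + (j - k) := by have := Finset.mem_range.1 hk; omega
      have hzz : z ^ j = z ^ k * z ^ (j - k) := by rw [← pow_add, ← this]
      rw [hzz]; ring
    constructor
    · refine (summable_norm_sum_mul_range_of_summable_norm hs ih.1).congr fun j => ?_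
      exact congrArg norm (e j).symm
    · rw [funext e]
      have := hasSum_sum_range_mul_of_summable_norm hs ih.1
      rw [ih.2.tsum_eq] at this
      rw [pow_succ, mul_comm]
      exact this

lemma chf_continuous (q : ℕ → ℝ) (hq : ∀ k, 0 ≤ q k) (h1 : HasSum q 1) : Continuous (chf q) := by
  refine continuous_tsum (u := q) (fun k => by fun_prop) h1.summable fun k t => ?_
  rw [norm_mul, norm_pow, norm_eit, one_pow, mul_one, Complex.norm_real, Real.norm_of_nonneg (hq k)]

lemma int_exp (i j : ℕ) : ∫ t in (-Real.pi)..Real.pi,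
    Complex.exp (Complex.I * t) ^ i * Complex.exp (-(Complex.I * t * j)) =
      if i = j then (2 * Real.pi : ℂ) else 0 := by
  have e : ∀ t : ℝ, Complex.exp (Complex.I * t) ^ i * Complex.exp (-(Complex.I * t * j)) =
      Complex.exp ((Complex.I * (i - j)) * t) := by
    intro t
    rw [← Complex.exp_nat_mul, ← Complex.exp_add]; congr 1; ring
  simp_rw [e]
  split_ifs with h
  · subst h; simp; ring
  · have hne : Complex.I * ((i : ℂ) - j) ≠ 0 := by
      refine mul_ne_zero Complex.I_ne_zero (sub_ne_zero.2 ?_)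
      exact_mod_cast h
    rw [integral_exp_mul_complex hne]
    have : Complex.exp (Complex.I * (i - j) * (Real.pi : ℝ)) = Complex.exp (Complex.I * (i - j) * ((-Real.pi : ℝ) : ℂ)) := by
      rw [Complex.exp_eq_exp_iff_exists_int]
      refine ⟨(i : ℤ) - j, ?_⟩
      push_cast; ring
    rw [this, sub_self, zero_div]

lemma inversion (q : ℕ → ℝ) (hq : ∀ k, 0 ≤ q k) (h1 : HasSum q 1) (n j : ℕ) :
    ∫ t in (-Real.pi)..Real.pi, chf q t ^ n * Complex.exp (-(Complex.I * t * j))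
      = 2 * Real.pi * convPow q n j := by
  have hs := (chf_pow_hasSum q hq h1 0 n).1
  have hn : ∀ (t : ℝ) (i : ℕ), ‖(convPow q n i : ℂ) * Complex.exp (Complex.I * t) ^ i‖ = ‖(convPow q n i : ℂ)‖ := by
    intro t i
    rw [norm_mul, norm_pow, norm_eit, one_pow, mul_one]
  simp_rw [hn] at hs
  have hE : ∀ t : ℝ, ‖Complex.exp (-(Complex.I * t * j))‖ = 1 := by
    intro t
    have : -(Complex.I * t * j) = ((-(t * j) : ℝ) : ℂ) * Complex.I := by push_cast; ring
    rw [this, Complex.norm_exp_ofReal_mul_I]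
  have H := intervalIntegral.hasSum_integral_of_dominated_convergence (μ := MeasureTheory.volume)
    (a := -Real.pi) (b := Real.pi)
    (F := fun (i : ℕ) (t : ℝ) => (convPow q n i : ℂ) * Complex.exp (Complex.I * t) ^ i * Complex.exp (-(Complex.I * t * j)))
    (f := fun t : ℝ => chf q t ^ n * Complex.exp (-(Complex.I * t * j)))
    (fun i _ => ‖(convPow q n i : ℂ)‖)
    (fun i => by
      apply Continuous.aestronglyMeasurable; fun_prop)
    (fun i => by
      refine Filter.Eventually.of_forall fun t _ => ?_
      rw [norm_mul, hn, hE, mul_one])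
    (Filter.Eventually.of_forall fun t _ => hs)
    (by simp)
    (Filter.Eventually.of_forall fun t _ => by
      exact (chf_pow_hasSum q hq h1 t n).2.mul_right _)
  rw [← H.tsum_eq]
  have e2 : ∀ i : ℕ, ∫ t in (-Real.pi)..Real.pi, (convPow q n i : ℂ) * Complex.exp (Complex.I * t) ^ i * Complex.exp (-(Complex.I * t * j)) = convPow q n i * (if i = j then (2 * Real.pi : ℂ) else 0) := by
    intro i
    rw [← int_exp, ← intervalIntegral.integral_const_mul]
    congr 1; ext t; ring
  rw [tsum_congr e2]
  rw [tsum_eq_single j]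
  · simp; ring
  · intro i hi; simp [hi]

/-- Hypotheses on the tilted law. -/
structure GoodLaw (q : ℕ → ℝ) (m V C : ℝ) : Prop where
  nonneg : ∀ k, 0 ≤ q k
  sum_one : HasSum q 1
  mean : HasSum (fun k : ℕ => (k : ℝ) * q k) m
  fact : HasSum (fun k : ℕ => (k : ℝ) * ((k : ℝ) - 1) * q k) V
  bound : V ≤ C * m ^ 2

lemma exp_second_order (y : ℕ → ℝ) (hy : Tendsto y atTop atTop) (s : ℝ) :
    Tendsto (fun n => (y n : ℂ) ^ 2 * (Complex.exp (Complex.I * ((s / y n : ℝ) : ℂ)) - 1 - Complex.I * ((s / y n : ℝ) : ℂ)))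
      atTop (𝓝 (-(s : ℂ) ^ 2 / 2)) := by
  have ht : Tendsto (fun n => s / y n) atTop (𝓝 0) := hy.const_div_atTop s
  have h0 : Tendsto (fun n => s ^ 2 * |s / y n| * Real.exp |s / y n|) atTop (𝓝 0) := by
    have h1 : Tendsto (fun n => |s / y n|) atTop (𝓝 0) := by simpa using ht.abs
    have h2 := (Real.continuous_exp.tendsto 0).comp h1
    have := (h1.const_mul (s ^ 2)).mul h2
    simpa using this
  rw [tendsto_iff_norm_sub_tendsto_zero]
  refine squeeze_zero' (Eventually.of_forall fun n => norm_nonneg _) ?_ h0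
  filter_upwards [hy.eventually_gt_atTop 0] with n hn
  set t := s / y n with ht_def
  have hst : s = y n * t := by rw [ht_def]; field_simp
  have h := Complex.norm_exp_sub_sum_le_norm_mul_exp (Complex.I * (t : ℂ)) 3
  have hnorm : ‖Complex.I * (t : ℂ)‖ = |t| := by simp
  rw [hnorm] at h
  simp only [Finset.sum_range_succ, Finset.sum_range_zero] at h
  have e : (y n : ℂ) ^ 2 * (Complex.exp (Complex.I * (t : ℂ)) - 1 - Complex.I * (t : ℂ)) - (-(s : ℂ) ^ 2 / 2)
    = (y n : ℂ) ^ 2 * (Complex.exp (Complex.I * (t : ℂ)) - (0 + (Complex.I * (t : ℂ)) ^ 0 / ((Nat.factorial 0 : ℕ) : ℂ) + (Complex.I * (t : ℂ)) ^ 1 / ((Nat.factorial 1 : ℕ) : ℂ) + (Complex.I * (t : ℂ)) ^ 2 / ((Nat.factorial 2 : ℕ) : ℂ))) := by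
    have hs : (s : ℂ) = y n * t := by exact_mod_cast hst
    rw [hs]
    simp [Nat.factorial, mul_pow]
    ring
  rw [e, norm_mul, norm_pow, Complex.norm_real, Real.norm_of_nonneg hn.le]
  calc y n ^ 2 * _ ≤ y n ^ 2 * (|t| ^ 3 * Real.exp |t|) := by gcongr
    _ = s ^ 2 * |t| * Real.exp |t| := by
      have : s ^ 2 = y n ^ 2 * |t| ^ 2 := by rw [hst, sq_abs]; ring
      rw [this]; ring

lemma pointwise_limit (q : ℕ → ℕ → ℝ) (x : ℕ → ℕ) (V : ℕ → ℝ) (C : ℝ) (hC : 0 ≤ C)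
    (hx_infty : Tendsto (fun n : ℕ => (x n : ℝ)) atTop atTop)
    (hx_small : Tendsto (fun n : ℕ => (x n : ℝ) / n) atTop (𝓝 0))
    (hG : ∀ᶠ n in atTop, GoodLaw (q n) ((x n : ℝ) / n) (V n) C) (s : ℝ) :
    Tendsto (fun n => chf (q n) (s / Real.sqrt (x n)) ^ n * Complex.exp (-(Complex.I * s * Real.sqrt (x n))))
      atTop (𝓝 (Complex.exp (-(s : ℂ) ^ 2 / 2))) := by
  have hy : Tendsto (fun n : ℕ => Real.sqrt (x n)) atTop atTop := Real.tendsto_sqrt_atTop.comp hx_infty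
  have ht : Tendsto (fun n => |s / Real.sqrt (x n)|) atTop (𝓝 0) := by
    simpa using (hy.const_div_atTop s).abs
  set K : ℝ := 1 + C / 2 with hK
  have hKpos : 0 < K := by positivity
  have hm1 : ∀ᶠ n : ℕ in atTop, (x n : ℝ) / n ≤ 1 := hx_small.eventually_le_const (by norm_num)
  have hmK : ∀ᶠ n : ℕ in atTop, (x n : ℝ) / n ≤ 1 / K := hx_small.eventually_le_const (by positivity)
  have ht1 : ∀ᶠ n : ℕ in atTop, |s / Real.sqrt (x n)| ≤ 1 := ht.eventually_le_const (by norm_num)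
  have hx0 := hx_infty.eventually_gt_atTop 0
  have hE : Tendsto (fun n : ℕ => (n : ℂ) * (chf (q n) (s / Real.sqrt (x n)) - 1) - Complex.I * s * Real.sqrt (x n)) atTop (𝓝 (-(s : ℂ) ^ 2 / 2)) := by
    have h1 := exp_second_order _ hy s
    have h2 : Tendsto (fun n : ℕ => (n : ℂ) * (chf (q n) (s / Real.sqrt (x n)) - 1 - (((x n : ℝ) / n : ℝ) : ℂ) * (Complex.exp (Complex.I * ((s / Real.sqrt (x n) : ℝ) : ℂ)) - 1))) atTop (𝓝 0) := by
      have h0 : Tendsto (fun n : ℕ => C / 2 * s ^ 2 * ((x n : ℝ) / n)) atTop (𝓝 0) := by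
        simpa using hx_small.const_mul (C / 2 * s ^ 2)
      refine squeeze_zero_norm' ?_ h0
      filter_upwards [hG, hx0, eventually_gt_atTop 0] with n hg hx hn
      have hn' : (0 : ℝ) < n := by exact_mod_cast hn
      have h := chf_taylor (q n) hg.nonneg hg.sum_one _ _ hg.mean hg.fact (s / Real.sqrt (x n))
      rw [norm_mul, Complex.norm_natCast]
      calc (n : ℝ) * _ ≤ n * (V n / 2 * (s / Real.sqrt (x n)) ^ 2) := by gcongr
        _ ≤ n * (C * ((x n : ℝ) / n) ^ 2 / 2 * (s / Real.sqrt (x n)) ^ 2) := by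
          have := hg.bound
          gcongr
        _ = _ := by
          have hxt : (s / Real.sqrt (x n)) ^ 2 = s ^ 2 / x n := by rw [div_pow, Real.sq_sqrt hx.le]
          rw [hxt]; field_simp
    have h3 := h2.add h1
    rw [zero_add] at h3
    refine h3.congr' ?_
    filter_upwards [hx0, eventually_gt_atTop 0] with n hx hn
    have hn' : (n : ℂ) ≠ 0 := by exact_mod_cast hn.ne'
    have hsq : ((Real.sqrt (x n) : ℝ) : ℂ) ^ 2 = (x n : ℂ) := by
      rw [← Complex.ofReal_pow, Real.sq_sqrt hx.le]; simp
    have hsq0 : ((Real.sqrt (x n) : ℝ) : ℂ) ≠ 0 := by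
      exact_mod_cast (Real.sqrt_pos.2 hx).ne'
    have e1 : (n : ℂ) * (((x n : ℝ) / n : ℝ) : ℂ) = (x n : ℂ) := by
      push_cast; field_simp
    have e2 : ((Real.sqrt (x n) : ℝ) : ℂ) ^ 2 * ((s / Real.sqrt (x n) : ℝ) : ℂ) = s * Real.sqrt (x n) := by
      push_cast; field_simp
    set z := Complex.exp (Complex.I * ((s / Real.sqrt (x n) : ℝ) : ℂ))
    linear_combination (1 - z) * e1 + (z - 1) * hsq - Complex.I * e2
  have hB : Tendsto (fun n : ℕ => Complex.exp (chf (q n) (s / Real.sqrt (x n)) - 1) ^ n * Complex.exp (-(Complex.I * s * Real.sqrt (x n)))) atTop (𝓝 (Complex.exp (-(s : ℂ) ^ 2 / 2))) := by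
    refine ((Complex.continuous_exp.tendsto _).comp hE).congr fun n => ?_
    rw [← Complex.exp_nat_mul, ← Complex.exp_add]
    simp only [Function.comp]
    congr 1
  have hD : Tendsto (fun n : ℕ => (chf (q n) (s / Real.sqrt (x n)) ^ n - Complex.exp (chf (q n) (s / Real.sqrt (x n)) - 1) ^ n) * Complex.exp (-(Complex.I * s * Real.sqrt (x n)))) atTop (𝓝 0) := by
    have h0 : Tendsto (fun n : ℕ => K ^ 2 * s ^ 2 * ((x n : ℝ) / n)) atTop (𝓝 0) := by
      simpa using hx_small.const_mul (K ^ 2 * s ^ 2)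
    refine squeeze_zero_norm' ?_ h0
    filter_upwards [hG, hx0, eventually_gt_atTop 0, hm1, hmK, ht1] with n hg hx hn hm1 hmK ht1
    have hn' : (0 : ℝ) < n := by exact_mod_cast hn
    have h := chf_taylor (q n) hg.nonneg hg.sum_one _ _ hg.mean hg.fact (s / Real.sqrt (x n))
    have hA := chf_norm_le_one (q n) hg.nonneg hg.sum_one (s / Real.sqrt (x n))
    have hVb := hg.bound
    have hxt : (s / Real.sqrt (x n)) ^ 2 = s ^ 2 / x n := by rw [div_pow, Real.sq_sqrt hx.le]
    set t := s / Real.sqrt (x n) with ht_def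
    set A := chf (q n) t
    set m : ℝ := (x n : ℝ) / n with hm
    have hm0 : 0 < m := by positivity
    have hE1 : ‖Complex.exp (-(Complex.I * s * Real.sqrt (x n)))‖ = 1 := by
      have : -(Complex.I * s * Real.sqrt (x n)) = ((-(s * Real.sqrt (x n)) : ℝ) : ℂ) * Complex.I := by push_cast; ring
      rw [this, Complex.norm_exp_ofReal_mul_I]
    have hBn : ‖Complex.exp (A - 1)‖ ≤ 1 := by
      rw [Complex.norm_exp, Real.exp_le_one_iff, Complex.sub_re, Complex.one_re]
      have := (Complex.re_le_norm A).trans hA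
      linarith
    have hA1 : ‖A - 1‖ ≤ K * m * |t| := by
      have h3 : ‖A - 1‖ ≤ ‖(m : ℂ) * (Complex.exp (Complex.I * t) - 1)‖ + ‖A - 1 - m * (Complex.exp (Complex.I * t) - 1)‖ := by
        refine le_trans (le_of_eq ?_) (norm_add_le _ _)
        congr 1; ring
      have h4 : ‖(m : ℂ) * (Complex.exp (Complex.I * t) - 1)‖ ≤ m * |t| := by
        rw [norm_mul, Complex.norm_real, Real.norm_of_nonneg hm0.le]
        gcongr
        exact Real.norm_exp_I_mul_ofReal_sub_one_le
      have h5 : V n / 2 * t ^ 2 ≤ C / 2 * (m * |t|) := by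
        calc V n / 2 * t ^ 2 ≤ (C * m ^ 2) / 2 * t ^ 2 := by gcongr
          _ = C / 2 * ((m * |t|) * (m * |t|)) := by rw [← sq_abs t]; ring
          _ ≤ C / 2 * ((m * |t|) * 1) := by
            have : m * |t| ≤ 1 := mul_le_one₀ hm1 (abs_nonneg _) ht1
            gcongr
          _ = _ := by ring
      rw [hK]; linarith
    have hA2 : ‖A - 1‖ ≤ 1 := by
      refine hA1.trans ?_
      have : K * m ≤ 1 := by
        rw [le_div_iff₀ hKpos] at hmK; linarith
      exact mul_le_one₀ this (abs_nonneg _) ht1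
    have hAB : ‖A - Complex.exp (A - 1)‖ ≤ ‖A - 1‖ ^ 2 := by
      have := Complex.norm_exp_sub_one_sub_id_le hA2
      rw [norm_sub_rev]
      refine le_trans (le_of_eq ?_) this
      congr 1; ring
    rw [norm_mul, hE1, mul_one]
    refine (pow_sub_pow_bound _ _ hA hBn n).trans ?_
    calc (n : ℝ) * _ ≤ n * (K * m * |t|) ^ 2 := by
          gcongr
          exact hAB.trans (by gcongr)
      _ = n * (K ^ 2 * m ^ 2 * t ^ 2) := by rw [mul_pow, mul_pow, sq_abs]
      _ = _ := by
        rw [hxt, hm]; field_simp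
  have := hD.add hB
  rw [zero_add] at this
  refine this.congr fun n => ?_
  ring

/-- The rescaled and truncated characteristic function. -/
noncomputable def Fn (q : ℕ → ℕ → ℝ) (x : ℕ → ℕ) (n : ℕ) (s : ℝ) : ℂ :=
  (Set.Ioc (-(Real.pi * Real.sqrt (x n))) (Real.pi * Real.sqrt (x n))).indicator
    (fun s : ℝ => chf (q n) (s / Real.sqrt (x n)) ^ n * Complex.exp (-(Complex.I * s * Real.sqrt (x n)))) s

lemma Fn_measurable (q : ℕ → ℕ → ℝ) (x : ℕ → ℕ) (n : ℕ) (m V C : ℝ) (h : GoodLaw (q n) m V C) :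
    MeasureTheory.AEStronglyMeasurable (Fn q x n) MeasureTheory.volume := by
  have hc := chf_continuous (q n) h.nonneg h.sum_one
  refine MeasureTheory.AEStronglyMeasurable.indicator ?_ measurableSet_Ioc
  apply Continuous.aestronglyMeasurable
  fun_prop

lemma Fn_bound (q : ℕ → ℕ → ℝ) (x : ℕ → ℕ) (n : ℕ) (V C : ℝ) (h : GoodLaw (q n) ((x n : ℝ) / n) V C)
    (hn : 0 < n) (hx : 0 < (x n : ℝ)) (hm2 : (x n : ℝ) / n ≤ 1 / 2) (hVm : V ≤ (x n : ℝ) / n / 10) (s : ℝ) :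
    ‖Fn q x n s‖ ≤ Real.exp (-(1 / 20) * s ^ 2) := by
  have hsq := Real.sqrt_pos.2 hx
  have hn' : (0 : ℝ) < n := by exact_mod_cast hn
  unfold Fn
  by_cases hs : s ∈ Set.Ioc (-(Real.pi * Real.sqrt (x n))) (Real.pi * Real.sqrt (x n))
  · rw [Set.indicator_of_mem hs]
    have hE1 : ‖Complex.exp (-(Complex.I * s * Real.sqrt (x n)))‖ = 1 := by
      have : -(Complex.I * s * Real.sqrt (x n)) = ((-(s * Real.sqrt (x n)) : ℝ) : ℂ) * Complex.I := by push_cast; ring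
      rw [this, Complex.norm_exp_ofReal_mul_I]
    rw [norm_mul, hE1, mul_one, norm_pow]
    have ht : |s / Real.sqrt (x n)| ≤ Real.pi := by
      rw [abs_div, abs_of_pos hsq, div_le_iff₀ hsq]
      exact abs_le.2 ⟨hs.1.le, hs.2⟩
    have hb := chf_norm_bound (q n) h.nonneg h.sum_one _ _ h.mean h.fact (by positivity) hm2 hVm _ ht
    calc _ ≤ Real.exp (-((x n : ℝ) / n * (s / Real.sqrt (x n)) ^ 2 / 20)) ^ n := by gcongr
      _ = _ := by
        rw [← Real.exp_nat_mul, div_pow, Real.sq_sqrt hx.le]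
        congr 1; field_simp
  · rw [Set.indicator_of_notMem hs, norm_zero]; positivity

lemma L1_limit (q : ℕ → ℕ → ℝ) (x : ℕ → ℕ) (V : ℕ → ℝ) (C : ℝ) (hC : 0 ≤ C)
    (hx_infty : Tendsto (fun n : ℕ => (x n : ℝ)) atTop atTop)
    (hx_small : Tendsto (fun n : ℕ => (x n : ℝ) / n) atTop (𝓝 0))
    (hG : ∀ᶠ n in atTop, GoodLaw (q n) ((x n : ℝ) / n) (V n) C) :
    (∀ᶠ n in atTop, MeasureTheory.Integrable (Fn q x n)) ∧
    Tendsto (fun n => ∫ s : ℝ, ‖Fn q x n s - Complex.exp (-(1 / 2 : ℂ) * s ^ 2)‖) atTop (𝓝 0) := by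
  have hx0 := hx_infty.eventually_gt_atTop 0
  have hm2 : ∀ᶠ n : ℕ in atTop, (x n : ℝ) / n ≤ 1 / 2 := hx_small.eventually_le_const (by norm_num)
  have hCm : ∀ᶠ n : ℕ in atTop, C * ((x n : ℝ) / n) ≤ 1 / 10 := by
    have : Tendsto (fun n : ℕ => C * ((x n : ℝ) / n)) atTop (𝓝 0) := by simpa using hx_small.const_mul C
    exact this.eventually_le_const (by norm_num)
  have hbound : ∀ᶠ n in atTop, ∀ s : ℝ, ‖Fn q x n s‖ ≤ Real.exp (-(1 / 20) * s ^ 2) := by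
    filter_upwards [hG, hx0, hm2, hCm, eventually_gt_atTop 0] with n hg hx hm2 hCm hn s
    refine Fn_bound q x n (V n) C hg hn hx hm2 ?_ s
    refine hg.bound.trans ?_
    have : (0 : ℝ) ≤ (x n : ℝ) / n := by positivity
    nlinarith
  have hi := integrable_exp_neg_mul_sq (b := 1 / 20) (by norm_num)
  have hi2 := integrable_exp_neg_mul_sq (b := 1 / 2) (by norm_num)
  have hg0 : Continuous (fun s : ℝ => Complex.exp (-(1 / 2 : ℂ) * s ^ 2)) := by fun_prop
  have hgn : ∀ s : ℝ, ‖Complex.exp (-(1 / 2 : ℂ) * s ^ 2)‖ = Real.exp (-(1 / 2) * s ^ 2) := by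
    intro s
    rw [← Complex.norm_of_nonneg (Real.exp_pos _).le]
    push_cast
    norm_num
  constructor
  · filter_upwards [hbound, hG] with n hb hg
    exact hi.mono' (Fn_measurable q x n _ _ _ hg) (Eventually.of_forall hb)
  · have := MeasureTheory.tendsto_integral_filter_of_dominated_convergence
      (μ := MeasureTheory.volume) (l := atTop)
      (F := fun n (s : ℝ) => ‖Fn q x n s - Complex.exp (-(1 / 2 : ℂ) * s ^ 2)‖) (f := fun _ => (0 : ℝ))
      (fun s : ℝ => Real.exp (-(1 / 20) * s ^ 2) + Real.exp (-(1 / 2) * s ^ 2))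
      (by
        filter_upwards [hG] with n hg
        exact ((Fn_measurable q x n _ _ _ hg).sub hg0.aestronglyMeasurable).norm)
      (by
        filter_upwards [hbound] with n hb
        refine Eventually.of_forall fun s => ?_
        rw [norm_norm]
        refine (norm_sub_le _ _).trans ?_
        rw [hgn]
        gcongr
        exact hb s)
      (hi.add hi2)
      (by
        refine Eventually.of_forall fun s => ?_
        rw [← tendsto_iff_norm_sub_tendsto_zero]
        have hp := pointwise_limit q x V C hC hx_infty hx_small hG s
        have e : (-(s : ℂ) ^ 2 / 2) = -(1 / 2 : ℂ) * s ^ 2 := by ring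
        rw [e] at hp
        refine hp.congr' ?_
        have hy : Tendsto (fun n : ℕ => Real.pi * Real.sqrt (x n)) atTop atTop :=
          (Real.tendsto_sqrt_atTop.comp hx_infty).const_mul_atTop Real.pi_pos
        filter_upwards [hy.eventually_gt_atTop |s|] with n hn
        unfold Fn
        rw [Set.indicator_of_mem]
        exact ⟨(abs_lt.1 hn).1, (abs_lt.1 hn).2.le⟩)
    simpa using this

lemma Fn_fourier (q : ℕ → ℕ → ℝ) (x : ℕ → ℕ) (n : ℕ) (m V C : ℝ) (h : GoodLaw (q n) m V C)
    (hx : 0 < (x n : ℝ)) (j : ℕ) :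
    ∫ s : ℝ, Fn q x n s * Complex.exp (Complex.I * ((-((j : ℝ) - x n) / Real.sqrt (x n) : ℝ) : ℂ) * s)
      = Real.sqrt (x n) * (2 * Real.pi * convPow (q n) n j) := by
  have hsq := Real.sqrt_pos.2 hx
  have hsqC : ((Real.sqrt (x n) : ℝ) : ℂ) ≠ 0 := by exact_mod_cast hsq.ne'
  have hsq2 : ((Real.sqrt (x n) : ℝ) : ℂ) ^ 2 = (x n : ℂ) := by
      rw [← Complex.ofReal_pow, Real.sq_sqrt hx.le]; simp
  have e : ∀ s : ℝ, Fn q x n s * Complex.exp (Complex.I * ((-((j : ℝ) - x n) / Real.sqrt (x n) : ℝ) : ℂ) * s)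
    = (Set.Ioc (-(Real.pi * Real.sqrt (x n))) (Real.pi * Real.sqrt (x n))).indicator
      (fun s : ℝ => (fun t : ℝ => chf (q n) t ^ n * Complex.exp (-(Complex.I * t * j))) (s / Real.sqrt (x n))) s := by
    intro s
    unfold Fn
    by_cases hs : s ∈ Set.Ioc (-(Real.pi * Real.sqrt (x n))) (Real.pi * Real.sqrt (x n))
    · rw [Set.indicator_of_mem hs, Set.indicator_of_mem hs, mul_assoc, ← Complex.exp_add]
      congr 2
      push_cast
      rw [← hsq2]
      field_simp
      ring
    · rw [Set.indicator_of_notMem hs, Set.indicator_of_notMem hs, zero_mul]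
  rw [funext e, MeasureTheory.integral_indicator measurableSet_Ioc, ← intervalIntegral.integral_of_le,
    intervalIntegral.integral_comp_div (fun t : ℝ => chf (q n) t ^ n * Complex.exp (-(Complex.I * t * j))) hsq.ne']
  · have e1 : -(Real.pi * Real.sqrt (x n)) / Real.sqrt (x n) = -Real.pi := by field_simp
    have e2 : (Real.pi * Real.sqrt (x n)) / Real.sqrt (x n) = Real.pi := by field_simp
    rw [e1, e2, inversion (q n) h.nonneg h.sum_one, Complex.real_smul]
  · have := Real.pi_pos
    nlinarith [mul_pos this hsq]

lemma gauss_fourier (u : ℝ) :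
    ∫ s : ℝ, Complex.exp (-(1 / 2 : ℂ) * s ^ 2) * Complex.exp (Complex.I * (u : ℂ) * s)
      = ((Real.sqrt (2 * Real.pi) * Real.exp (-u ^ 2 / 2) : ℝ) : ℂ) := by
  have h := fourierIntegral_gaussian (b := 1 / 2) (by norm_num) (u : ℂ)
  simp_rw [mul_comm (Complex.exp (-(1 / 2 : ℂ) * _))]
  rw [h]
  push_cast
  congr 1
  · rw [Real.sqrt_eq_rpow, Complex.ofReal_cpow (by positivity)]
    push_cast
    congr 1
    ring
  · congr 1; ring

lemma core_limit (q : ℕ → ℕ → ℝ) (x : ℕ → ℕ) (V : ℕ → ℝ) (C : ℝ) (hC : 0 ≤ C)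
    (hx_infty : Tendsto (fun n : ℕ => (x n : ℝ)) atTop atTop)
    (hx_small : Tendsto (fun n : ℕ => (x n : ℝ) / n) atTop (𝓝 0))
    (hG : ∀ᶠ n in atTop, GoodLaw (q n) ((x n : ℝ) / n) (V n) C) :
    ∀ ε > 0, ∀ᶠ n in atTop, ∀ j : ℕ,
      |Real.sqrt (x n) * convPow (q n) n j -
        (Real.sqrt (2 * Real.pi))⁻¹ *
          Real.exp (-((j : ℝ) - (x n : ℝ)) ^ 2 / (2 * (x n : ℝ)))| < ε := by
  intro ε hε
  obtain ⟨hFint, hlim⟩ := L1_limit q x V C hC hx_infty hx_small hG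
  filter_upwards [hFint, hlim.eventually_lt_const hε, hG, hx_infty.eventually_gt_atTop 0] with n hi hl hg hx j
  refine lt_of_le_of_lt ?_ hl
  have hsq := Real.sqrt_pos.2 hx
  set u : ℝ := -((j : ℝ) - x n) / Real.sqrt (x n) with hu
  have hE1 : ∀ s : ℝ, ‖Complex.exp (Complex.I * (u : ℂ) * s)‖ = 1 := by
    intro s
    have : Complex.I * (u : ℂ) * s = ((u * s : ℝ) : ℂ) * Complex.I := by push_cast; ring
    rw [this, Complex.norm_exp_ofReal_mul_I]
  have hEc : Continuous (fun s : ℝ => Complex.exp (Complex.I * (u : ℂ) * s)) := by fun_prop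
  have hgi : MeasureTheory.Integrable (fun s : ℝ => Complex.exp (-(1 / 2 : ℂ) * s ^ 2)) :=
    integrable_cexp_neg_mul_sq (by norm_num)
  have hmul : ∀ f : ℝ → ℂ, MeasureTheory.Integrable f → MeasureTheory.Integrable (fun s : ℝ => f s * Complex.exp (Complex.I * (u : ℂ) * s)) := by
    intro f hf
    exact hf.mul_bdd (c := 1) hEc.aestronglyMeasurable (Eventually.of_forall fun s => (hE1 s).le)
  have h1 := Fn_fourier q x n _ _ _ hg hx j
  have h2 := gauss_fourier u
  have h3 : ∫ s : ℝ, (Fn q x n s - Complex.exp (-(1 / 2 : ℂ) * s ^ 2)) * Complex.exp (Complex.I * (u : ℂ) * s)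
      = ((2 * Real.pi * (Real.sqrt (x n) * convPow (q n) n j -
        (Real.sqrt (2 * Real.pi))⁻¹ *
          Real.exp (-((j : ℝ) - (x n : ℝ)) ^ 2 / (2 * (x n : ℝ)))) : ℝ) : ℂ) := by
    simp_rw [sub_mul]
    rw [MeasureTheory.integral_sub (hmul _ hi) (hmul _ hgi), h1, h2]
    have hu2 : -u ^ 2 / 2 = -((j : ℝ) - (x n : ℝ)) ^ 2 / (2 * (x n : ℝ)) := by
      rw [hu, div_pow, Real.sq_sqrt hx.le]; field_simp
    rw [hu2]
    have hs2 : 2 * Real.pi * (Real.sqrt (2 * Real.pi))⁻¹ = Real.sqrt (2 * Real.pi) := by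
      have hp : 0 < 2 * Real.pi := by positivity
      have := Real.sqrt_pos.2 hp
      field_simp
      rw [Real.sq_sqrt hp.le]
    have e3 : ∀ E : ℝ, Real.sqrt (2 * Real.pi) * E = 2 * Real.pi * ((Real.sqrt (2 * Real.pi))⁻¹ * E) := by
      intro E; rw [← mul_assoc, hs2]
    rw [e3]
    push_cast
    ring
  have h4 := congrArg norm h3
  rw [Complex.norm_real, Real.norm_eq_abs, abs_mul, abs_of_pos (by positivity : 0 < 2 * Real.pi)] at h4
  have h5 : ‖∫ s : ℝ, (Fn q x n s - Complex.exp (-(1 / 2 : ℂ) * s ^ 2)) * Complex.exp (Complex.I * (u : ℂ) * s)‖ ≤ ∫ s : ℝ, ‖Fn q x n s - Complex.exp (-(1 / 2 : ℂ) * s ^ 2)‖ := by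
    refine (MeasureTheory.norm_integral_le_integral_norm _).trans (le_of_eq ?_)
    congr 1; ext s
    rw [norm_mul, hE1, mul_one]
  rw [h4] at h5
  refine le_trans ?_ h5
  have hpi : 1 ≤ 2 * Real.pi := by linarith [Real.pi_gt_three]
  exact le_mul_of_one_le_left (abs_nonneg _) hpi

lemma convPow_tilt (p : ℕ → ℝ) (b G : ℝ) (n j : ℕ) :
    convPow (fun k => p k * b ^ k / G) n j = b ^ j / G ^ n * convPow p n j := by
  induction n generalizing j with
  | zero =>
    by_cases h : j = 0
    · subst h; simp [convPow]
    · simp [convPow, h]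
  | succ n ih =>
    rw [convPow, convPow, Finset.mul_sum]
    refine Finset.sum_congr rfl fun k hk => ?_
    rw [ih]
    have : j = (j - k) + k := by have := Finset.mem_range.1 hk; omega
    have hb : b ^ j = b ^ (j - k) * b ^ k := by rw [← pow_add, ← this]
    rw [hb, pow_succ, div_mul_eq_div_div]
    ring

lemma summable_sq (p : ℕ → ℝ) (ρ : ℝ)
    (hρ_conv : ∀ s : ℝ, 0 ≤ s → s < ρ → Summable (fun k : ℕ => p k * s ^ k))
    (r : ℝ) (hr0 : 0 < r) (hr : r < ρ) : Summable (fun k : ℕ => (k : ℝ) ^ 2 * (p k * r ^ k)) := by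
  set r' := (r + ρ) / 2 with hr'
  have h1 : r < r' := by rw [hr']; linarith
  have h2 : r' < ρ := by rw [hr']; linarith
  have h0 : 0 < r' := hr0.trans h1
  refine summable_of_isBigO_nat (hρ_conv r' h0.le h2).norm ?_
  refine Asymptotics.IsBigO.of_bound 1 ?_
  have ht := tendsto_pow_const_mul_const_pow_of_lt_one 2 (r := r / r') (by positivity) ((div_lt_one h0).2 h1)
  filter_upwards [ht.eventually_le_const (show (0 : ℝ) < 1 by norm_num)] with k hk
  have e : (k : ℝ) ^ 2 * (p k * r ^ k) = ((k : ℝ) ^ 2 * (r / r') ^ k) * (p k * r' ^ k) := by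
    rw [div_pow]; field_simp
  rw [e, norm_mul, norm_norm]
  gcongr
  rw [Real.norm_of_nonneg (by positivity)]
  exact hk

lemma genFun_deriv (p : ℕ → ℝ) (hp : ∀ k, 0 ≤ p k) (ρ : ℝ)
    (hρ_conv : ∀ s : ℝ, 0 ≤ s → s < ρ → Summable (fun k : ℕ => p k * s ^ k))
    (b : ℝ) (hb0 : 0 < b) (hb : b < ρ) :
    HasSum (fun k : ℕ => (k : ℝ) * (p k * b ^ k)) (b * deriv (genFun p) b) := by
  set r := (b + ρ) / 2 with hr
  have h1 : b < r := by rw [hr]; linarith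
  have h2 : r < ρ := by rw [hr]; linarith
  have h0 : 0 < r := hb0.trans h1
  have hd : HasDerivAt (genFun p) (∑' k : ℕ, p k * ((k : ℝ) * b ^ (k - 1))) b := by
    refine hasDerivAt_tsum_of_isPreconnected (t := Set.Ioo 0 r) (y₀ := b)
      (g := fun k y => p k * y ^ k) (g' := fun k y => p k * ((k : ℝ) * y ^ (k - 1)))
      ((summable_sq p ρ hρ_conv r h0 h2).mul_right r⁻¹) isOpen_Ioo isPreconnected_Ioo ?_ ?_
      ⟨hb0, h1⟩ (hρ_conv b hb0.le hb) ⟨hb0, h1⟩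
    · intro k y _
      exact (hasDerivAt_pow k y).const_mul (p k)
    · intro k y hy
      have hy0 : 0 ≤ y := hy.1.le
      rw [Real.norm_of_nonneg (mul_nonneg (hp k) (by positivity))]
      rcases k with _ | k
      · simp
      · rw [Nat.add_sub_cancel]
        have h3 : y ^ k ≤ r ^ k := pow_le_pow_left₀ hy0 hy.2.le k
        have h4 : ((k + 1 : ℕ) : ℝ) ≤ ((k + 1 : ℕ) : ℝ) ^ 2 := by
          have : (1 : ℝ) ≤ ((k + 1 : ℕ) : ℝ) := by exact_mod_cast Nat.succ_pos k
          nlinarith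
        calc p (k + 1) * (((k + 1 : ℕ) : ℝ) * y ^ k) ≤ p (k + 1) * (((k + 1 : ℕ) : ℝ) ^ 2 * r ^ k) := by
              apply mul_le_mul_of_nonneg_left _ (hp _)
              gcongr
          _ = _ := by
            have e : r ^ (k + 1) = r ^ k * r := pow_succ r k
            rw [e]; field_simp
  have hs : Summable (fun k : ℕ => (k : ℝ) * (p k * b ^ k)) := by
    refine Summable.of_nonneg_of_le (fun k => ?_) (fun k => ?_) (summable_sq p ρ hρ_conv b hb0 hb)
    · have := hp k; positivity
    · have := hp k
      have h4 : (k : ℝ) ≤ (k : ℝ) ^ 2 := by exact_mod_cast Nat.le_self_pow two_ne_zero k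
      gcongr
  rw [hd.deriv, ← tsum_mul_left]
  have e : (fun k : ℕ => b * (p k * ((k : ℝ) * b ^ (k - 1)))) = fun k : ℕ => (k : ℝ) * (p k * b ^ k) := by
    ext k
    rcases k with _ | k
    · simp
    · rw [Nat.add_sub_cancel, pow_succ]; ring
  rw [e]
  exact hs.hasSum

lemma good_tilt (p : ℕ → ℝ) (hp : ∀ k, 0 ≤ p k) (ρ : ℝ) (hρ : 0 < ρ)
    (hρ_conv : ∀ s : ℝ, 0 ≤ s → s < ρ → Summable (fun k : ℕ => p k * s ^ k))
    (hp0 : 0 < p 0) (hp1 : 0 < p 1) :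
    ∃ C : ℝ, 0 ≤ C ∧ ∃ δ > 0, ∀ b m : ℝ, b ∈ Set.Ioo 0 ρ → PsiFun p b = m → m ≤ δ →
      ∃ V, GoodLaw (fun k => p k * b ^ k / genFun p b) m V C := by
  set r := ρ / 2 with hr
  have hr0 : 0 < r := by positivity
  have hS := summable_sq p ρ hρ_conv r hr0 (by rw [hr]; linarith)
  set S := ∑' k : ℕ, (k : ℝ) ^ 2 * (p k * r ^ k) with hSdef
  have hS0 : 0 ≤ S := tsum_nonneg fun k => by have := hp k; positivity
  refine ⟨(2 * p 0 / p 1) ^ 2 * S / (r ^ 2 * p 0), by positivity, min (1 / 2) (r * p 1 / (2 * p 0)), by positivity, ?_⟩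
  rintro b m ⟨hb0, hbρ⟩ hm hmδ
  have hm2 : m ≤ 1 / 2 := hmδ.trans (min_le_left _ _)
  have hm3 : m ≤ r * p 1 / (2 * p 0) := hmδ.trans (min_le_right _ _)
  have hGs : HasSum (fun k : ℕ => p k * b ^ k) (genFun p b) := (hρ_conv b hb0.le hbρ).hasSum
  have hD := genFun_deriv p hp ρ hρ_conv b hb0 hbρ
  have hnn : ∀ k, 0 ≤ p k * b ^ k := fun k => by have := hp k; positivity
  have hGp0 : p 0 ≤ genFun p b := by
    have := le_hasSum hGs 0 fun k _ => hnn k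
    simpa using this
  have hGpos : 0 < genFun p b := hp0.trans_le hGp0
  have hmul : b * deriv (genFun p) b = m * genFun p b := by
    rw [← hm, PsiFun]; field_simp
  rw [hmul] at hD
  have hp1b : p 1 * b ≤ m * genFun p b := by
    have := le_hasSum hD 1 fun k _ => mul_nonneg (Nat.cast_nonneg k) (hnn k)
    simpa using this
  have hGle : genFun p b - p 0 ≤ m * genFun p b := by
    have h1 : HasSum (fun k : ℕ => if k = 0 then p 0 else 0) (p 0) := by
      simpa using hasSum_ite_eq (0 : ℕ) (p 0)
    refine hasSum_le (fun k => ?_) (hGs.sub h1) hD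
    rcases k with _ | k
    · simp
    · have h2 : (1 : ℝ) ≤ ((k + 1 : ℕ) : ℝ) := by exact_mod_cast Nat.succ_pos k
      have := hnn (k + 1)
      simp only [Nat.add_eq_zero_iff, one_ne_zero, and_false, if_false, sub_zero]
      nlinarith
  have hG2 : genFun p b ≤ 2 * p 0 := by nlinarith
  have hm0 : 0 ≤ m := by
    by_contra hneg
    push Not at hneg
    nlinarith [mul_pos hp1 hb0]
  have hbm : b ≤ 2 * p 0 / p 1 * m := by
    rw [div_mul_eq_mul_div, le_div_iff₀ hp1]
    nlinarith
  have hbr : b ≤ r := by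
    refine hbm.trans ?_
    calc 2 * p 0 / p 1 * m ≤ 2 * p 0 / p 1 * (r * p 1 / (2 * p 0)) := by gcongr
      _ = r := by field_simp
  have hk1 : ∀ k : ℕ, (0 : ℝ) ≤ (k : ℝ) * ((k : ℝ) - 1) := by
    intro k
    rcases k with _ | k
    · simp
    · push_cast; nlinarith [(Nat.cast_nonneg k : (0 : ℝ) ≤ k)]
  have hle : ∀ k : ℕ, (k : ℝ) * ((k : ℝ) - 1) * (p k * b ^ k) ≤ (b / r) ^ 2 * ((k : ℝ) ^ 2 * (p k * r ^ k)) := by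
    intro k
    rcases k with _ | _ | k
    · simp
    · simp; have := hp 1; positivity
    · have h1 : b ^ k ≤ r ^ k := pow_le_pow_left₀ hb0.le hbr k
      have hpk := hp (k + 2)
      have h2 : (((k + 1 + 1 : ℕ) : ℝ)) * (((k + 1 + 1 : ℕ) : ℝ) - 1) ≤ ((k + 1 + 1 : ℕ) : ℝ) ^ 2 := by
        have : (0 : ℝ) ≤ ((k + 1 + 1 : ℕ) : ℝ) := Nat.cast_nonneg _
        nlinarith
      calc _ ≤ ((k + 1 + 1 : ℕ) : ℝ) ^ 2 * (p (k + 1 + 1) * (b ^ 2 * r ^ k)) := by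
            have e : b ^ (k + 1 + 1) = b ^ 2 * b ^ k := by ring
            rw [e]
            gcongr
        _ = _ := by
            have e : r ^ (k + 1 + 1) = r ^ 2 * r ^ k := by ring
            rw [e, div_pow]; field_simp
  have hsum := hS.hasSum.mul_left ((b / r) ^ 2)
  have hVs : Summable (fun k : ℕ => (k : ℝ) * ((k : ℝ) - 1) * (p k * b ^ k)) :=
    Summable.of_nonneg_of_le (fun k => mul_nonneg (hk1 k) (hnn k)) hle hsum.summable
  have hVle := hasSum_le hle hVs.hasSum hsum
  refine ⟨(∑' k : ℕ, (k : ℝ) * ((k : ℝ) - 1) * (p k * b ^ k)) / genFun p b, ?_, ?_, ?_, ?_, ?_⟩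
  · intro k; exact div_nonneg (hnn k) hGpos.le
  · have := hGs.div_const (genFun p b)
    rwa [div_self hGpos.ne'] at this
  · have := hD.div_const (genFun p b)
    rw [mul_div_cancel_right₀ _ hGpos.ne'] at this
    have e : (fun k : ℕ => (k : ℝ) * (p k * b ^ k / genFun p b)) = fun k : ℕ => (k : ℝ) * (p k * b ^ k) / genFun p b := by
      ext k; ring
    rw [e]; exact this
  · have := hVs.hasSum.div_const (genFun p b)
    have e : (fun k : ℕ => (k : ℝ) * ((k : ℝ) - 1) * (p k * b ^ k / genFun p b)) = fun k : ℕ => (k : ℝ) * ((k : ℝ) - 1) * (p k * b ^ k) / genFun p b := by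
      ext k; ring
    rw [e]; exact this
  · calc _ ≤ ((b / r) ^ 2 * S) / p 0 := by gcongr
      _ ≤ ((2 * p 0 / p 1 * m / r) ^ 2 * S) / p 0 := by gcongr
      _ = _ := by field_simp
/-- **Small endpoint local limit theorem** (Theorem 1.1(ii)), with `v_n = √x_n`.
The supremum over `k ≥ -x_n` is expressed as a uniform bound over `j = x_n + k ∈ ℕ`. -/
theorem small_endpoint_local_limit_theorem
    (p : ℕ → ℝ) (hp_nonneg : ∀ k, 0 ≤ p k) (hp_prob : ∑' k : ℕ, p k = 1)
    (hp_aperiodic : ¬ ∃ (a h : ℤ), 2 ≤ h ∧ ∀ k : ℕ, 0 < p k → h ∣ ((k : ℤ) - a))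
    (ρ : ℝ) (hρ : 0 < ρ)
    (hρ_conv : ∀ s : ℝ, 0 ≤ s → s < ρ → Summable (fun k : ℕ => p k * s ^ k))
    (hρ_div : ∀ s : ℝ, ρ < s → ¬ Summable (fun k : ℕ => p k * s ^ k))
    (hp0 : 0 < p 0) (hp1 : 0 < p 1)
    (x : ℕ → ℕ) (hx_pos : ∀ n, 1 ≤ x n)
    (hx_infty : Tendsto (fun n : ℕ => (x n : ℝ)) atTop atTop)
    (hx_small : Tendsto (fun n : ℕ => (x n : ℝ) / n) atTop (𝓝 0))
    (b : ℕ → ℝ)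
    (hb : ∀ᶠ n in atTop, b n ∈ Set.Ioo (0 : ℝ) ρ ∧ PsiFun p (b n) = (x n : ℝ) / n) :
    ∀ ε > 0, ∀ᶠ n in atTop, ∀ j : ℕ,
      |Real.sqrt (x n) * ((b n) ^ j / (genFun p (b n)) ^ n) * convPow p n j -
        (Real.sqrt (2 * Real.pi))⁻¹ *
          Real.exp (-((j : ℝ) - (x n : ℝ)) ^ 2 / (2 * (x n : ℝ)))| < ε := by
  obtain ⟨C, hC, δ, hδ, h⟩ := good_tilt p hp_nonneg ρ hρ hρ_conv hp0 hp1
  have hev : ∀ᶠ n in atTop, ∃ V, GoodLaw (fun k => p k * b n ^ k / genFun p (b n)) ((x n : ℝ) / n) V C := by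
    filter_upwards [hb, hx_small.eventually_le_const hδ] with n hn hd
    exact h _ _ hn.1 hn.2 hd
  have hV : ∃ V : ℕ → ℝ, ∀ n, (∃ v, GoodLaw (fun k => p k * b n ^ k / genFun p (b n)) ((x n : ℝ) / n) v C) →
      GoodLaw (fun k => p k * b n ^ k / genFun p (b n)) ((x n : ℝ) / n) (V n) C := by
    classical
    refine ⟨fun n => if hn : ∃ v, GoodLaw (fun k => p k * b n ^ k / genFun p (b n)) ((x n : ℝ) / n) v C
      then hn.choose else 0, fun n hn => ?_⟩
    simp only [dif_pos hn]
    exact hn.choose_spec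
  obtain ⟨V, hV⟩ := hV
  intro ε hε
  have := core_limit (fun n k => p k * b n ^ k / genFun p (b n)) x V C hC hx_infty hx_small
    (hev.mono fun n hn => hV n hn) ε hε
  filter_upwards [this] with n hn j
  have hj := hn j
  rw [convPow_tilt, ← mul_assoc] at hj
  exact hj
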